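/- Let F ∈ 𝓕₁(I) be strictly increasing. Then every strictly decreasing square iterative root of F in 𝓕(I) is, on I ∖ J(F), uniquely determined by its restriction to the subintervals in Λ(F): if f, g ∈ 𝓕(I) are strictly decreasing with f²(x) = g²(x) = F(x) for all x ∈ I and f(x) = g(x) for all x in every subinterval belonging to Λ(F), then f(x) = g(x) for all x ∈ I ∖ J(F). -/

import Mathlib

open Set Filter Topology

/-- Iterates of a multifunction: `Iter F 0 x = {x}`, `Iter F (n+1) x = F (Iter F n x)`. -/
def Iter (F : ℝ → Set ℝ) : ℕ → ℝ → Set ℝ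
  | 0 => fun x => {x}
  | n + 1 => fun x => ⋃ y ∈ Iter F n x, F y

/-- Composition of multifunctions: `(G ∘ F)(x) = ⋃ y ∈ F x, G y`. -/
def Comp (G F : ℝ → Set ℝ) : ℝ → Set ℝ := fun x => ⋃ y ∈ F x, G y

/-- Image of a set under a multifunction: `F(A) = ⋃ x ∈ A, F x`. -/
def ImageOf (F : ℝ → Set ℝ) (A : Set ℝ) : Set ℝ := ⋃ x ∈ A, F x

/-- `F` is a multifunction on `[a,b]`: nonempty compact values contained in `[a,b]`. -/
def MFOn (a b : ℝ) (F : ℝ → Set ℝ) : Prop :=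
  ∀ x ∈ Icc a b, (F x).Nonempty ∧ IsCompact (F x) ∧ F x ⊆ Icc a b

/-- Upper semicontinuity of a multifunction at a point, relative to a domain `S`. -/
def USCWithin (S : Set ℝ) (F : ℝ → Set ℝ) (x : ℝ) : Prop :=
  ∀ V : Set ℝ, IsOpen V → F x ⊆ V → ∃ U ∈ 𝓝 x, ∀ y ∈ U ∩ S, F y ⊆ V

/-- Upper semicontinuity on `[a,b]`. -/
def USCOn (a b : ℝ) (F : ℝ → Set ℝ) : Prop :=
  ∀ x ∈ Icc a b, USCWithin (Icc a b) F x

/-- Strictly increasing multifunction: `max F(x) < min F(y)` whenever `x < y` in `[a,b]`. -/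
def SIncOn (a b : ℝ) (F : ℝ → Set ℝ) : Prop :=
  ∀ x ∈ Icc a b, ∀ y ∈ Icc a b, x < y → ∀ u ∈ F x, ∀ v ∈ F y, u < v

/-- Strictly decreasing multifunction: `min F(x) > max F(y)` whenever `x < y` in `[a,b]`. -/
def SDecOn (a b : ℝ) (F : ℝ → Set ℝ) : Prop :=
  ∀ x ∈ Icc a b, ∀ y ∈ Icc a b, x < y → ∀ u ∈ F x, ∀ v ∈ F y, v < u

/-- The class 𝓕(I) of strictly monotone usc multifunctions on `I = [a,b]`. -/
def ClassF (a b : ℝ) (F : ℝ → Set ℝ) : Prop :=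
  MFOn a b F ∧ USCOn a b F ∧ (SIncOn a b F ∨ SDecOn a b F)

/-- The set `J(F)` of jumps (set-valued points) of `F` in `[a,b]`. -/
def Jumps (a b : ℝ) (F : ℝ → Set ℝ) : Set ℝ :=
  {x | x ∈ Icc a b ∧ (F x).Nontrivial}

/-- `k` is the intensity `ζ(F)`: the least `k` with `#J(F^k) = #J(F^{k+1})`. -/
def IsIntensity (a b : ℝ) (F : ℝ → Set ℝ) (k : ℕ) : Prop :=
  IsLeast {j : ℕ | (Jumps a b (Iter F j)).ncard = (Jumps a b (Iter F (j + 1))).ncard} k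

/-- Exclusive multifunctions 𝓕₁(I): members of 𝓕(I) with finitely many jumps and intensity 1. -/
def Exclusive (a b : ℝ) (F : ℝ → Set ℝ) : Prop :=
  ClassF a b F ∧ (Jumps a b F).Finite ∧ IsIntensity a b F 1

/-- Enumeration of the jumps: `c 0 = a`, `c (m+1) = b`, `c` strictly increasing on `{0,…,m+1}`,
and the jumps of `F` are exactly `c 1 < … < c m`.  The subintervals are `I_i = (c i, c (i+1))`. -/
def JumpEnum (a b : ℝ) (F : ℝ → Set ℝ) (m : ℕ) (c : ℕ → ℝ) : Prop :=
  c 0 = a ∧ c (m + 1) = b ∧ (∀ i j : ℕ, i < j → j ≤ m + 1 → c i < c j) ∧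
    Jumps a b F = {x | ∃ i : ℕ, 1 ≤ i ∧ i ≤ m ∧ x = c i}

/-- Hypothesis (H): `F` is strictly increasing, `max F(x) < x` on `(a,b)`, and `max F(b) ≤ b`. -/
def HypH (a b : ℝ) (F : ℝ → Set ℝ) : Prop :=
  SIncOn a b F ∧ (∀ x ∈ Ioo a b, ∀ u ∈ F x, u < x) ∧ (∀ u ∈ F b, u ≤ b)

theorem iter_two (F : ℝ → Set ℝ) (x : ℝ) : Iter F 2 x = ⋃ y ∈ F x, F y := by
  simp [Iter]

theorem SIncOn.eq_of_mem {a b : ℝ} {F : ℝ → Set ℝ} (h : SIncOn a b F) {x y u : ℝ}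
    (hx : x ∈ Icc a b) (hy : y ∈ Icc a b) (hux : u ∈ F x) (huy : u ∈ F y) : x = y := by
  rcases lt_trichotomy x y with hxy | hxy | hxy
  · exact absurd (h x hx y hy hxy u hux u huy) (lt_irrefl u)
  · exact hxy
  · exact absurd (h y hy x hx hxy u huy u hux) (lt_irrefl u)

theorem SDecOn.eq_of_mem {a b : ℝ} {F : ℝ → Set ℝ} (h : SDecOn a b F) {x y u : ℝ}
    (hx : x ∈ Icc a b) (hy : y ∈ Icc a b) (hux : u ∈ F x) (huy : u ∈ F y) : x = y := by
  rcases lt_trichotomy x y with hxy | hxy | hxy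
  · exact absurd (h x hx y hy hxy u hux u huy) (lt_irrefl u)
  · exact hxy
  · exact absurd (h y hy x hx hxy u huy u hux) (lt_irrefl u)

/-- A jump of a multifunction with pairwise disjoint values is a jump of its second iterate. -/
theorem jumps_subset_jumps_iter_two {a b : ℝ} {F : ℝ → Set ℝ} (hF : MFOn a b F)
    (hinj : ∀ x ∈ Icc a b, ∀ y ∈ Icc a b, ∀ u ∈ F x, u ∈ F y → x = y) :
    Jumps a b F ⊆ Jumps a b (Iter F 2) := by
  rintro x ⟨hx, u, hu, v, hv, huv⟩
  have huI := (hF x hx).2.2 hu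
  have hvI := (hF x hx).2.2 hv
  obtain ⟨p, hp⟩ := (hF u huI).1
  obtain ⟨q, hq⟩ := (hF v hvI).1
  refine ⟨hx, p, ?_, q, ?_, ?_⟩
  · rw [iter_two]
    exact mem_biUnion hu hp
  · rw [iter_two]
    exact mem_biUnion hv hq
  · rintro rfl
    exact huv (hinj u huI v hvI p hp hq)

/-- A value of an exclusive increasing multifunction at a point that is not a jump is not a jump. -/
theorem Exclusive.notMem_jumps {a b : ℝ} {F : ℝ → Set ℝ} (hF : Exclusive a b F)
    (hinc : SIncOn a b F) {x y : ℝ} (hx : x ∈ Icc a b) (hxJ : x ∉ Jumps a b F) (hy : y ∈ F x) :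
    y ∉ Jumps a b F := by
  obtain ⟨⟨hMF, -, -⟩, -, hmem, hleast⟩ := hF
  have hone : Iter F 1 = F := by
    funext t
    simp [Iter]
  have hzero : Jumps a b (Iter F 0) = ∅ := by
    ext t
    simp [Jumps, Iter]
  simp only [mem_ofPred_eq, hone] at hmem
  norm_num at hmem
  have hfin : (Jumps a b (Iter F 2)).Finite := by
    by_contra hinf
    have h0 : (Jumps a b F).ncard = 0 := by rw [hmem, Set.Infinite.ncard hinf]
    have h1 : 1 ≤ 0 := hleast (by simp [hzero, hone, h0])
    omega
  have hJ : Jumps a b F = Jumps a b (Iter F 2) :=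
    Set.eq_of_subset_of_ncard_le
      (jumps_subset_jumps_iter_two hMF fun x hx y hy u hu hu' => hinc.eq_of_mem hx hy hu hu')
      hmem.ge hfin
  intro hyJ
  apply hxJ
  rw [hJ]
  refine ⟨hx, hyJ.2.mono ?_⟩
  rw [iter_two]
  exact subset_biUnion_of_mem (u := F) hy

theorem eq_singleton_of_notMem_jumps {a b : ℝ} {F : ℝ → Set ℝ} (hF : MFOn a b F) {x : ℝ}
    (hx : x ∈ Icc a b) (hxJ : x ∉ Jumps a b F) : ∃ y ∈ Icc a b, F x = {y} := by
  obtain ⟨y, hy⟩ := (hF x hx).1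
  refine ⟨y, (hF x hx).2.2 hy, ?_⟩
  have hs : (F x).Subsingleton := Set.not_nontrivial_iff.1 fun h => hxJ ⟨hx, h⟩
  exact hs.eq_singleton_of_mem hy

/-- On a preconnected set where an usc multifunction is single-valued and omits the value `r`,
its values stay on one side of `r`. -/
theorem USCOn.no_crossing {a b : ℝ} {F : ℝ → Set ℝ} (hF : USCOn a b F) {S : Set ℝ}
    (hS : IsPreconnected S) (hSI : S ⊆ Icc a b) (hsing : ∀ x ∈ S, ∃ y, F x = {y}) {r : ℝ}
    (hr : ∀ x ∈ S, r ∉ F x) {p x : ℝ} (hp : p ∈ S) (hx : x ∈ S)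
    (hpF : F p ⊆ Iio r) : F x ⊆ Iio r := by
  by_contra hxF
  have hnhds : ∀ V : Set ℝ, IsOpen V → ∀ t ∈ S, F t ⊆ V →
      ∃ U, IsOpen U ∧ t ∈ U ∧ ∀ s ∈ U ∩ S, F s ⊆ V := by
    intro V hV t ht htV
    obtain ⟨U, hU, hUV⟩ := hF t (hSI ht) V hV htV
    obtain ⟨W, hWU, hWo, htW⟩ := mem_nhds_iff.1 hU
    exact ⟨W, hWo, htW, fun s hs => hUV s ⟨hWU hs.1, hSI hs.2⟩⟩
  let O : Set ℝ → Set ℝ := fun V => ⋃₀ {U | IsOpen U ∧ ∀ s ∈ U ∩ S, F s ⊆ V}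
  have hO : ∀ V, IsOpen (O V) := fun V => isOpen_sUnion fun U hU => hU.1
  have hmemO : ∀ V, IsOpen V → ∀ t ∈ S, F t ⊆ V → t ∈ O V := by
    intro V hV t ht htV
    obtain ⟨U, hUo, htU, hUV⟩ := hnhds V hV t ht htV
    exact ⟨U, ⟨hUo, hUV⟩, htU⟩
  have hOmem : ∀ V, ∀ t ∈ S, t ∈ O V → F t ⊆ V := by
    rintro V t ht ⟨U, ⟨-, hUV⟩, htU⟩
    exact hUV t ⟨htU, ht⟩
  have hdich : ∀ t ∈ S, F t ⊆ Iio r ∨ F t ⊆ Ioi r := by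
    intro t ht
    obtain ⟨y, hy⟩ := hsing t ht
    have hne := hr t ht
    rw [hy] at hne ⊢
    simpa using lt_or_gt_of_ne (Ne.symm hne)
  obtain ⟨t, htS, ht1, ht2⟩ := hS (O (Iio r)) (O (Ioi r)) (hO _) (hO _)
    (fun t ht => (hdich t ht).imp (hmemO _ isOpen_Iio t ht) (hmemO _ isOpen_Ioi t ht))
    ⟨p, hp, hmemO _ isOpen_Iio p hp hpF⟩
    ⟨x, hx, hmemO _ isOpen_Ioi x hx ((hdich x hx).resolve_left hxF)⟩
  obtain ⟨y, hy⟩ := hsing t htS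
  have h1 := hOmem _ t htS ht1
  have h2 := hOmem _ t htS ht2
  rw [hy, singleton_subset_iff] at h1 h2
  exact lt_asymm (mem_Iio.1 h1) (mem_Ioi.1 h2)

/-- Usc multifunctions that agree at points arbitrarily close to `x` agree at `x` if both are
single-valued there. -/
theorem USCOn.eq_of_frequently_eq {a b : ℝ} {f g : ℝ → Set ℝ} (hf : USCOn a b f)
    (hg : USCOn a b g) {x y z : ℝ} (hx : x ∈ Icc a b) (hy : f x = {y}) (hz : g x = {z})
    (hfg : ∀ U ∈ 𝓝 x, ∃ t ∈ U ∩ Icc a b, (f t).Nonempty ∧ f t = g t) : y = z := by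
  by_contra hne
  obtain ⟨V, W, hV, hW, hyV, hzW, hVW⟩ := t2_separation hne
  obtain ⟨U₁, hU₁, h₁⟩ := hf x hx V hV (by simpa [hy] using hyV)
  obtain ⟨U₂, hU₂, h₂⟩ := hg x hx W hW (by simpa [hz] using hzW)
  obtain ⟨t, ⟨htU, htI⟩, ⟨w, hw⟩, heq⟩ := hfg _ (inter_mem hU₁ hU₂)
  exact disjoint_left.1 hVW (h₁ t ⟨htU.1, htI⟩ hw) (h₂ t ⟨htU.2, htI⟩ (heq ▸ hw))

/-- A point between `c 0` and `c (m + 1)` other than `c 1, …, c m` lies in one of the gaps. -/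
theorem exists_mem_Ioo_of_ne (c : ℕ → ℝ) (m : ℕ) {q : ℝ} (h0 : c 0 < q) (h1 : q < c (m + 1))
    (hne : ∀ k, 1 ≤ k → k ≤ m → q ≠ c k) : ∃ j ≤ m, q ∈ Ioo (c j) (c (j + 1)) := by
  induction m with
  | zero => exact ⟨0, le_rfl, h0, h1⟩
  | succ m ih =>
    rcases lt_or_gt_of_ne (hne (m + 1) (by omega) le_rfl) with h | h
    · obtain ⟨j, hj, hq⟩ := ih h fun k hk hkm => hne k hk (by omega)
      exact ⟨j, by omega, hq⟩
    · exact ⟨m + 1, le_rfl, h, h1⟩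

/-- If `l` is monotone on `{0, …, m}` and `P` holds at its fixed points and pulls back along `l`,
then `P` holds on all of `{0, …, m}`. -/
theorem forall_of_monotone_pullback {m : ℕ} {l : ℕ → ℕ} {P : ℕ → Prop} (hl : ∀ i ≤ m, l i ≤ m)
    (hmono : ∀ i j, i ≤ j → j ≤ m → l i ≤ l j) (hfix : ∀ i ≤ m, l i = i → P i)
    (hpull : ∀ i ≤ m, P (l i) → P i) : ∀ i ≤ m, P i := by
  have hdown : ∀ i ≤ m, l i ≤ i → P i := by
    intro i
    induction i using Nat.strong_induction_on with
    | _ i ih =>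
      intro hi hle
      rcases hle.eq_or_lt with h | h
      · exact hfix i hi h
      · exact hpull i hi (ih (l i) h (hl i hi) (hmono _ _ hle hi))
  have hup : ∀ d i, i ≤ m → m - i = d → i ≤ l i → P i := by
    intro d
    induction d using Nat.strong_induction_on with
    | _ d ih =>
      intro i hi hd hle
      have hli := hl i hi
      rcases hle.eq_or_lt with h | h
      · exact hfix i hi h.symm
      · exact hpull i hi (ih (m - l i) (by omega) (l i) hli rfl (hmono _ _ hle hli))
  intro i hi
  rcases le_total (l i) i with h | h
  · exact hdown i hi h
  · exact hup _ i hi rfl h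

theorem JumpEnum.monotone {a b : ℝ} {F : ℝ → Set ℝ} {m : ℕ} {c : ℕ → ℝ} (hc : JumpEnum a b F m c)
    {i j : ℕ} (hij : i ≤ j) (hj : j ≤ m + 1) : c i ≤ c j := by
  rcases hij.eq_or_lt with rfl | h
  · exact le_rfl
  · exact (hc.2.2.1 i j h hj).le

theorem JumpEnum.Ioo_subset {a b : ℝ} {F : ℝ → Set ℝ} {m : ℕ} {c : ℕ → ℝ}
    (hc : JumpEnum a b F m c) {i : ℕ} (hi : i ≤ m) : Ioo (c i) (c (i + 1)) ⊆ Ioo a b := by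
  have h1 := hc.monotone (Nat.zero_le i) (by omega)
  have h2 := hc.monotone (show i + 1 ≤ m + 1 by omega) le_rfl
  rw [hc.1] at h1
  rw [hc.2.1] at h2
  exact Ioo_subset_Ioo h1 h2

theorem JumpEnum.notMem_jumps {a b : ℝ} {F : ℝ → Set ℝ} {m : ℕ} {c : ℕ → ℝ}
    (hc : JumpEnum a b F m c) {i : ℕ} (hi : i ≤ m) {x : ℝ} (hx : x ∈ Ioo (c i) (c (i + 1))) :
    x ∉ Jumps a b F := by
  rw [hc.2.2.2]
  rintro ⟨k, hk1, hkm, rfl⟩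
  rcases Nat.lt_or_ge i k with h | h
  · exact absurd hx.2 (hc.monotone (show i + 1 ≤ k by omega) (by omega)).not_gt
  · exact absurd hx.1 (hc.monotone h (by omega)).not_gt

theorem JumpEnum.exists_mem_Ioo {a b : ℝ} {F : ℝ → Set ℝ} {m : ℕ} {c : ℕ → ℝ}
    (hc : JumpEnum a b F m c) {x : ℝ} (hx : x ∈ Ioo a b) (hxJ : x ∉ Jumps a b F) :
    ∃ j ≤ m, x ∈ Ioo (c j) (c (j + 1)) := by
  refine exists_mem_Ioo_of_ne c m (hc.1 ▸ hx.1) (hc.2.1 ▸ hx.2) fun k hk1 hkm hk => hxJ ?_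
  rw [hc.2.2.2]
  exact ⟨k, hk1, hkm, hk⟩

theorem SIncOn.image_mem_Ioo {a b : ℝ} {F : ℝ → Set ℝ} (hMF : MFOn a b F) (hinc : SIncOn a b F)
    {x u : ℝ} (hx : x ∈ Ioo a b) (hu : u ∈ F x) : u ∈ Ioo a b := by
  have hab : a ≤ b := (hx.1.trans hx.2).le
  obtain ⟨p, hp⟩ := (hMF a ⟨le_rfl, hab⟩).1
  obtain ⟨q, hq⟩ := (hMF b ⟨hab, le_rfl⟩).1
  exact ⟨((hMF a ⟨le_rfl, hab⟩).2.2 hp).1.trans_lt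
      (hinc a ⟨le_rfl, hab⟩ x (Ioo_subset_Icc_self hx) hx.1 p hp u hu),
    (hinc x (Ioo_subset_Icc_self hx) b ⟨hab, le_rfl⟩ hx.2 u hu q hq).trans_le
      ((hMF b ⟨hab, le_rfl⟩).2.2 hq).2⟩

/-- An exclusive increasing multifunction maps each gap between jumps into a single such gap. -/
theorem Exclusive.exists_imageOf_subset {a b : ℝ} {F : ℝ → Set ℝ} (hF : Exclusive a b F)
    (hinc : SIncOn a b F) {m : ℕ} {c : ℕ → ℝ} (hc : JumpEnum a b F m c) {i : ℕ} (hi : i ≤ m) :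
    ∃ j ≤ m, ImageOf F (Ioo (c i) (c (i + 1))) ⊆ Ioo (c j) (c (j + 1)) := by
  have hMF := hF.1.1
  have hsubI : Ioo (c i) (c (i + 1)) ⊆ Icc a b := (hc.Ioo_subset hi).trans Ioo_subset_Icc_self
  have hsing : ∀ x ∈ Ioo (c i) (c (i + 1)), ∃ y, F x = {y} := fun x hx => by
    obtain ⟨y, -, hy⟩ := eq_singleton_of_notMem_jumps hMF (hsubI hx) (hc.notMem_jumps hi hx)
    exact ⟨y, hy⟩
  have hgap : ∀ x ∈ Ioo (c i) (c (i + 1)), ∀ u ∈ F x, ∃ j ≤ m, u ∈ Ioo (c j) (c (j + 1)) :=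
    fun x hx u hu => hc.exists_mem_Ioo (SIncOn.image_mem_Ioo hMF hinc (hc.Ioo_subset hi hx) hu)
      (hF.notMem_jumps hinc (hsubI hx) (hc.notMem_jumps hi hx) hu)
  have homit : ∀ k ≤ m + 1, ∀ x ∈ Ioo (c i) (c (i + 1)), c k ∉ F x := by
    intro k hk x hx hkx
    obtain ⟨j, hj, h1, h2⟩ := hgap x hx _ hkx
    rcases Nat.lt_or_ge j k with h | h
    · exact absurd h2 (hc.monotone (show j + 1 ≤ k by omega) hk).not_gt
    · exact absurd h1 (hc.monotone h (by omega)).not_gt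
  obtain ⟨p, hp⟩ := nonempty_Ioo.2 (hc.2.2.1 i (i + 1) (by omega) (by omega))
  obtain ⟨q, hq⟩ := hsing p hp
  obtain ⟨j, hj, hqj⟩ := hgap p hp q (by simp [hq])
  refine ⟨j, hj, iUnion₂_subset fun x hx u hu => ⟨?_, ?_⟩⟩
  · by_contra hle
    obtain ⟨v, hv⟩ := hsing x hx
    have huv : u = v := by simpa [hv] using hu
    have hlt : u < c j :=
      lt_of_le_of_ne (not_lt.1 hle) fun h => homit j (by omega) x hx (h ▸ hu)
    have := hF.1.2.1.no_crossing isPreconnected_Ioo hsubI hsing (homit j (by omega)) hx hp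
      (by simpa [hv, ← huv] using hlt)
    rw [hq, singleton_subset_iff] at this
    exact lt_asymm hqj.1 this
  · exact hF.1.2.1.no_crossing isPreconnected_Ioo hsubI hsing (homit (j + 1) (by omega)) hp hx
      (by simpa [hq] using hqj.2) hu

/-- Composing a square root of `F` with `F` does not depend on the order. -/
theorem biUnion_root_comm {a b : ℝ} {f F : ℝ → Set ℝ} (hf : MFOn a b f)
    (hroot : ∀ x ∈ Icc a b, Iter f 2 x = F x) {x : ℝ} (hx : x ∈ Icc a b) :
    ⋃ y ∈ f x, F y = ⋃ y ∈ F x, f y := by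
  rw [← hroot x hx, iter_two, biUnion_iUnion]
  simp only [biUnion_iUnion]
  refine iUnion₂_congr fun y hy => ?_
  rw [← hroot y ((hf x hx).2.2 hy), iter_two]

theorem SIncOn.subset_of_biUnion_subset {a b : ℝ} {F : ℝ → Set ℝ} (hMF : MFOn a b F)
    (hinc : SIncOn a b F) {A B : Set ℝ} (hA : A ⊆ Icc a b) (hB : B ⊆ Icc a b)
    (h : ⋃ y ∈ A, F y ⊆ ⋃ y ∈ B, F y) : A ⊆ B := by
  intro u hu
  obtain ⟨w, hw⟩ := (hMF u (hA hu)).1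
  obtain ⟨v, hv, hwv⟩ := mem_iUnion₂.1 (h (mem_biUnion hu hw))
  exact hinc.eq_of_mem (hA hu) (hB hv) hw hwv ▸ hv

/-- Two square roots of an increasing `F` that agree on `F x` agree at `x`. -/
theorem eq_of_eq_on_image {a b : ℝ} {f g F : ℝ → Set ℝ} (hMF : MFOn a b F) (hinc : SIncOn a b F)
    (hf : MFOn a b f) (hg : MFOn a b g) (hfroot : ∀ x ∈ Icc a b, Iter f 2 x = F x)
    (hgroot : ∀ x ∈ Icc a b, Iter g 2 x = F x) {x : ℝ} (hx : x ∈ Icc a b)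
    (h : ∀ y ∈ F x, f y = g y) : f x = g x := by
  have key : ⋃ y ∈ f x, F y = ⋃ y ∈ g x, F y := by
    rw [biUnion_root_comm hf hfroot hx, biUnion_root_comm hg hgroot hx]
    exact iUnion₂_congr h
  exact (hinc.subset_of_biUnion_subset hMF (hf x hx).2.2 (hg x hx).2.2 key.le).antisymm
    (hinc.subset_of_biUnion_subset hMF (hg x hx).2.2 (hf x hx).2.2 key.ge)

theorem jumps_root_subset {a b : ℝ} {f F : ℝ → Set ℝ} (hf : MFOn a b f) (hdec : SDecOn a b f)
    (hroot : ∀ x ∈ Icc a b, Iter f 2 x = F x) : Jumps a b f ⊆ Jumps a b F := by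
  intro x hx
  have h := jumps_subset_jumps_iter_two hf
    (fun x hx y hy u hu hu' => hdec.eq_of_mem hx hy hu hu') hx
  exact ⟨hx.1, hroot x hx.1 ▸ h.2⟩

/-- a strictly decreasing square iterative root of a strictly increasing
`F ∈ 𝓕₁(I)` is uniquely determined on `I ∖ J(F)` by its restriction to the subintervals
in `Λ(F)`. -/
theorem stmt16 (a b : ℝ) (hab : a < b) (F : ℝ → Set ℝ) (hF : Exclusive a b F)
    (hFinc : SIncOn a b F) (m : ℕ) (c : ℕ → ℝ) (hc : JumpEnum a b F m c)
    (f g : ℝ → Set ℝ) (hf : ClassF a b f) (hg : ClassF a b g)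
    (hfdec : SDecOn a b f) (hgdec : SDecOn a b g)
    (hfroot : ∀ x ∈ Icc a b, Iter f 2 x = F x)
    (hgroot : ∀ x ∈ Icc a b, Iter g 2 x = F x)
    (heq : ∀ i ≤ m, ImageOf F (Ioo (c i) (c (i + 1))) ⊆ Ioo (c i) (c (i + 1)) →
      ∀ x ∈ Ioo (c i) (c (i + 1)), f x = g x) :
    ∀ x ∈ Icc a b \ Jumps a b F, f x = g x := by
  have hMF := hF.1.1
  choose! l hl hlsub using fun i (hi : i ≤ m) => hF.exists_imageOf_subset hFinc hc hi
  have hmono : ∀ i j, i ≤ j → j ≤ m → l i ≤ l j := by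
    intro i j hij hj
    rcases hij.eq_or_lt with rfl | hij
    · exact le_rfl
    by_contra! hlt
    have hi : i ≤ m := by omega
    obtain ⟨p, hp⟩ := nonempty_Ioo.2 (hc.2.2.1 i (i + 1) (by omega) (by omega))
    obtain ⟨q, hq⟩ := nonempty_Ioo.2 (hc.2.2.1 j (j + 1) (by omega) (by omega))
    have hpI := Ioo_subset_Icc_self (hc.Ioo_subset hi hp)
    have hqI := Ioo_subset_Icc_self (hc.Ioo_subset hj hq)
    obtain ⟨u, hu⟩ := (hMF p hpI).1
    obtain ⟨v, hv⟩ := (hMF q hqI).1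
    have hpq : p < q :=
      hp.2.trans_le ((hc.monotone (show i + 1 ≤ j by omega) (by omega)).trans hq.1.le)
    have huv := hFinc p hpI q hqI hpq u hu v hv
    have hu' := (hlsub i hi (mem_biUnion hp hu)).1
    have hv' := (hlsub j hj (mem_biUnion hq hv)).2
    have hli := hl i hi
    have hle := hc.monotone (show l j + 1 ≤ l i by omega) (by omega)
    linarith
  have hgaps : ∀ i ≤ m, ∀ x ∈ Ioo (c i) (c (i + 1)), f x = g x := by
    refine forall_of_monotone_pullback hl hmono (fun i hi hfix => ?_) fun i hi hP x hx => ?_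
    · have h := hlsub i hi
      rw [hfix] at h
      exact heq i hi h
    · exact eq_of_eq_on_image hMF hFinc hf.1 hg.1 hfroot hgroot
        (Ioo_subset_Icc_self (hc.Ioo_subset hi hx)) fun y hy => hP y (hlsub i hi (mem_biUnion hx hy))
  rintro x ⟨hx, hxJ⟩
  by_cases hxo : x ∈ Ioo a b
  · obtain ⟨i, hi, hxi⟩ := hc.exists_mem_Ioo hxo hxJ
    exact hgaps i hi x hxi
  obtain ⟨y, -, hy⟩ := eq_singleton_of_notMem_jumps hf.1 hx
    fun h => hxJ (jumps_root_subset hf.1 hfdec hfroot h)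
  obtain ⟨z, -, hz⟩ := eq_singleton_of_notMem_jumps hg.1 hx
    fun h => hxJ (jumps_root_subset hg.1 hgdec hgroot h)
  obtain ⟨i, hi, hxi⟩ : ∃ i ≤ m, x ∈ closure (Ioo (c i) (c (i + 1))) := by
    have hends : x = a ∨ x = b := by
      by_contra! h
      exact hxo ⟨lt_of_le_of_ne hx.1 h.1.symm, lt_of_le_of_ne hx.2 h.2⟩
    rcases hends with rfl | rfl
    · have h := hc.2.2.1 0 1 (by omega) (by omega)
      refine ⟨0, by omega, ?_⟩
      rw [closure_Ioo h.ne, hc.1]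
      exact ⟨le_rfl, hc.1 ▸ h.le⟩
    · have h := hc.2.2.1 m (m + 1) (by omega) le_rfl
      refine ⟨m, le_rfl, ?_⟩
      rw [closure_Ioo h.ne, hc.2.1]
      exact ⟨hc.2.1 ▸ h.le, le_rfl⟩
  rw [hy, hz, hf.2.1.eq_of_frequently_eq hg.2.1 hx hy hz fun U hU => ?_]
  obtain ⟨t, htU, hti⟩ := mem_closure_iff_nhds.1 hxi U hU
  have htI := Ioo_subset_Icc_self (hc.Ioo_subset hi hti)
  exact ⟨t, ⟨htU, htI⟩, (hf.1 t htI).1, hgaps i hi t hti⟩
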